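/- (Discrete Grönwall-type bound.) Let (v_k), (c_k) be sequences of nonnegative reals, let d ≥ 0 and D₁ ≥ 0 be reals with Σ_{t=0}^{∞} c_t ≤ D₁ and v_{k+1} ≤ (1 + c_k)·v_k + d·c_k for all k ≥ 0. Then for every k ≥ 0: v_k ≤ v_0·e^{D₁} + d·D₁·e^{2D₁}. -/

import Mathlib

/-- Discrete Grönwall inequality in terms of the partial sums of the coefficients. -/
theorem le_add_mul_sum_mul_exp_sum {v c : ℕ → ℝ} (hv : ∀ k, 0 ≤ v k) (hc : ∀ k, 0 ≤ c k)
    {d : ℝ} (hd : 0 ≤ d) (hrec : ∀ k, v (k + 1) ≤ (1 + c k) * v k + d * c k) (k : ℕ) :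
    v k ≤ (v 0 + d * ∑ t ∈ Finset.range k, c t) * Real.exp (∑ t ∈ Finset.range k, c t) := by
  induction k with
  | zero => simp
  | succ k ih =>
    rw [Finset.sum_range_succ]
    set S := ∑ t ∈ Finset.range k, c t
    have hS0 : 0 ≤ S := Finset.sum_nonneg fun t _ => hc t
    have hck := hc k
    have hone : 1 + c k ≤ Real.exp (c k) := by linarith [Real.add_one_le_exp (c k)]
    calc v (k + 1) ≤ (1 + c k) * v k + d * c k := hrec k
      _ ≤ Real.exp (c k) * ((v 0 + d * S) * Real.exp S) + d * c k * Real.exp (S + c k) := by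
        refine add_le_add (mul_le_mul hone ih (hv k) (Real.exp_nonneg _)) ?_
        exact le_mul_of_one_le_right (by positivity) (Real.one_le_exp (by positivity))
      _ = (v 0 + d * (S + c k)) * Real.exp (S + c k) := by
        rw [Real.exp_add]; ring

/-- Discrete Grönwall-type bound: if `v_{k+1} ≤ (1 + c_k) v_k + d c_k` with `c` summable
with sum at most `D₁`, then `v_k ≤ v_0 e^{D₁} + d D₁ e^{2D₁}` for every `k`. -/
theorem stmt18 (v c : ℕ → ℝ) (hv : ∀ k, 0 ≤ v k) (hc : ∀ k, 0 ≤ c k)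
    (d D₁ : ℝ) (hd : 0 ≤ d) (hD₁ : 0 ≤ D₁)
    (hsummable : Summable c) (htsum : ∑' t, c t ≤ D₁)
    (hrec : ∀ k, v (k + 1) ≤ (1 + c k) * v k + d * c k) :
    ∀ k, v k ≤ v 0 * Real.exp D₁ + d * D₁ * Real.exp (2 * D₁) := by
  intro k
  have hS : ∑ t ∈ Finset.range k, c t ≤ D₁ :=
    (hsummable.sum_le_tsum _ fun t _ => hc t).trans htsum
  have hv0 := hv 0
  calc v k ≤ (v 0 + d * ∑ t ∈ Finset.range k, c t) * Real.exp (∑ t ∈ Finset.range k, c t) :=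
        le_add_mul_sum_mul_exp_sum hv hc hd hrec k
    _ ≤ (v 0 + d * D₁) * Real.exp D₁ := by gcongr
    _ = v 0 * Real.exp D₁ + d * D₁ * Real.exp D₁ := by ring
    _ ≤ v 0 * Real.exp D₁ + d * D₁ * Real.exp (2 * D₁) := by
      gcongr
      linarith
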